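/- Let p be a symmetric transition probability on ℤ with finite variance, let α > 0, β ≥ 0, let n ≥ 1 be an integer, let S be a subset of {(x,z) ∈ ℤ × ℤ : min(x,z) ≤ -1 and max(x,z) ≥ 0} that is closed under swapping coordinates, and let F be the set of ordered pairs (x,z) ∈ ℤ × ℤ with x ≠ z not belonging to S. Then for every G ∈ C_c^∞(ℝ) and every configuration η : ℤ → {0,1}, all the series below converge absolutely and the following identity holds: (1/n) Σ_{z∈ℤ} n² K_n G(z/n) η(z) + (n/2)(1 − α n^{−β}) Σ_{(x,z)∈S} [G(x/n) − G(z/n)] p(z−x) (η(x) − η(z)) = α n^{1−β} Σ_{(x,z)∈S} [G(x/n) − G(z/n)] p(x−z) η(z) + n Σ_{(x,z)∈F} [G(x/n) − G(z/n)] p(x−z) η(z). -/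

import Mathlib

open scoped BigOperators
open Filter Set

/-- A compactly supported function vanishes at all but finitely many points of the lattice
`ℤ / n`. -/
lemma finite_support_lattice {G : ℝ → ℝ} (hGc : HasCompactSupport G) {n : ℕ} (hn : n ≠ 0) :
    (Function.support fun x : ℤ => G ((x : ℝ) / n)).Finite := by
  have hn' : (n : ℝ) ≠ 0 := Nat.cast_ne_zero.mpr hn
  have hK : IsCompact ((fun y : ℝ => y * n) '' tsupport G) := hGc.isCompact.image (by fun_prop)
  have hfin : ((Int.cast : ℤ → ℝ) ⁻¹' ((fun y : ℝ => y * n) '' tsupport G)).Finite :=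
    (Int.isClosedEmbedding_coe_real.isCompact_preimage hK).finite_of_discrete
  refine hfin.subset fun x hx => ⟨(x : ℝ) / n, subset_tsupport G hx, ?_⟩
  exact div_mul_cancel₀ _ hn'

lemma summable_mul_convolution_kernel {g p : ℤ → ℝ} (hg : Summable g) (hp : Summable p) :
    Summable fun q : ℤ × ℤ => g q.1 * p (q.1 - q.2) := by
  let e : ℤ × ℤ ≃ ℤ × ℤ :=
    ⟨fun q => (q.1, q.1 - q.2), fun q => (q.1, q.1 - q.2), fun q => by simp, fun q => by simp⟩
  exact e.summable_iff.mpr (summable_mul_of_summable_norm hg.norm hp.norm)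

lemma summable_increment_kernel {g p : ℤ → ℝ} (hg : Summable g) (hp : Summable p)
    (hpsymm : ∀ z, p (-z) = p z) :
    Summable fun q : ℤ × ℤ => (g q.1 - g q.2) * p (q.1 - q.2) := by
  have h := summable_mul_convolution_kernel hg hp
  refine (h.sub ((Equiv.prodComm ℤ ℤ).summable_iff.mpr h)).congr fun q => ?_
  have hq : p (q.2 - q.1) = p (q.1 - q.2) := by rw [← hpsymm, neg_sub]
  simp [hq, sub_mul]

lemma summable_mul_of_abs_le_one {ι : Type*} {f w : ι → ℝ} (hf : Summable f)
    (hw : ∀ i, |w i| ≤ 1) : Summable fun i => f i * w i := by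
  refine Summable.of_norm_bounded hf.norm fun i => ?_
  rw [norm_mul]
  exact mul_le_of_le_one_right (norm_nonneg _) (hw i)

/-- For an antisymmetric kernel on a symmetric set, exchanging the coordinates of the weight
changes the sign of the sum. -/
lemma tsum_antisymm_swap {S : Set (ℤ × ℤ)} (hS : ∀ x z : ℤ, (x, z) ∈ S → (z, x) ∈ S)
    {a : ℤ × ℤ → ℝ} (ha : ∀ q, a q.swap = -a q) (η : ℤ → ℝ) :
    ∑' q : S, a q * η q.1.1 = -∑' q : S, a q * η q.1.2 := by
  classical
  rw [tsum_subtype S fun q => a q * η q.1, tsum_subtype S fun q => a q * η q.2,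
    ← (Equiv.prodComm ℤ ℤ).tsum_eq, ← tsum_neg]
  refine tsum_congr fun q => ?_
  have hmem : q.swap ∈ S ↔ q ∈ S := ⟨hS _ _, hS _ _⟩
  simp only [Equiv.prodComm_apply, Set.indicator_apply, hmem, ha, Prod.fst_swap]
  split_ifs <;> simp

lemma tsum_eq_add_tsum_off_diagonal {S : Set (ℤ × ℤ)} {f : ℤ × ℤ → ℝ} (hf : Summable f)
    (hdiag : ∀ x, f (x, x) = 0) :
    ∑' q, f q = ∑' q : S, f q + ∑' q : {q : ℤ × ℤ | q.1 ≠ q.2 ∧ q ∉ S}, f q := by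
  classical
  rw [← (hf.subtype S).tsum_add_tsum_compl (hf.subtype Sᶜ), tsum_subtype Sᶜ f,
    tsum_subtype {q : ℤ × ℤ | q.1 ≠ q.2 ∧ q ∉ S} f]
  congr 1
  refine tsum_congr fun ⟨x, z⟩ => ?_
  by_cases hxz : x = z
  · subst hxz
    simp [Set.indicator_apply, hdiag]
  · simp [Set.indicator_apply, hxz]

/-- The shear `(z, y) ↦ (z + y, z)` of `ℤ × ℤ`. -/
def shearEquiv : ℤ × ℤ ≃ ℤ × ℤ where
  toFun q := (q.1 + q.2, q.1)
  invFun q := (q.2, q.1 - q.2)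
  left_inv q := by simp
  right_inv q := by simp

lemma summable_shear {f : ℤ × ℤ → ℝ} (hf : Summable f) :
    Summable fun q : ℤ × ℤ => f (q.1 + q.2, q.1) :=
  shearEquiv.summable_iff.mpr hf

lemma tsum_tsum_shear {f : ℤ × ℤ → ℝ} (hf : Summable f) :
    ∑' z, ∑' y, f (z + y, z) = ∑' q, f q :=
  (summable_shear hf).tsum_prod.symm.trans (shearEquiv.tsum_eq f)

/-- decomposition of the action of the generator on the empirical measure. -/
theorem generator_decomposition
    (p : ℤ → ℝ) (hpnn : ∀ z, 0 ≤ p z) (hp0 : p 0 = 0)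
    (hpsymm : ∀ z, p (-z) = p z) (hpsum : Summable p) (hptot : ∑' z, p z = 1)
    (hpvar : Summable (fun z : ℤ => (z : ℝ) ^ 2 * p z))
    (α β : ℝ) (hα : 0 < α) (hβ : 0 ≤ β)
    (n : ℕ) (hn : 1 ≤ n)
    (S : Set (ℤ × ℤ))
    (hS : S ⊆ {q : ℤ × ℤ | min q.1 q.2 ≤ -1 ∧ 0 ≤ max q.1 q.2})
    (hSswap : ∀ x z : ℤ, (x, z) ∈ S → (z, x) ∈ S)
    (F : Set (ℤ × ℤ)) (hF : F = {q : ℤ × ℤ | q.1 ≠ q.2 ∧ q ∉ S})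
    (G : ℝ → ℝ) (hG : ContDiff ℝ (⊤ : ℕ∞) G) (hGc : HasCompactSupport G)
    (η : ℤ → ℝ) (hη : ∀ x, η x = 0 ∨ η x = 1) :
    (∀ x : ℤ, Summable (fun z : ℤ => (G (((x : ℝ) + z) / n) - G ((x : ℝ) / n)) * p z)) ∧
    Summable (fun z : ℤ =>
      (n : ℝ) ^ 2 * (∑' y : ℤ, (G (((z : ℝ) + y) / n) - G ((z : ℝ) / n)) * p y) * η z) ∧
    Summable (fun q : S =>
      (G ((q.1.1 : ℝ) / n) - G ((q.1.2 : ℝ) / n)) * p (q.1.2 - q.1.1) * (η q.1.1 - η q.1.2)) ∧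
    Summable (fun q : S =>
      (G ((q.1.1 : ℝ) / n) - G ((q.1.2 : ℝ) / n)) * p (q.1.1 - q.1.2) * η q.1.2) ∧
    Summable (fun q : F =>
      (G ((q.1.1 : ℝ) / n) - G ((q.1.2 : ℝ) / n)) * p (q.1.1 - q.1.2) * η q.1.2) ∧
    (1 / n : ℝ) *
        (∑' z : ℤ, (n : ℝ) ^ 2 * (∑' y : ℤ, (G (((z : ℝ) + y) / n) - G ((z : ℝ) / n)) * p y) * η z)
      + (n / 2 : ℝ) * (1 - α * (n : ℝ) ^ (-β)) *
        (∑' q : S, (G ((q.1.1 : ℝ) / n) - G ((q.1.2 : ℝ) / n)) * p (q.1.2 - q.1.1)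
            * (η q.1.1 - η q.1.2))
    = α * (n : ℝ) ^ ((1 : ℝ) - β) *
        (∑' q : S, (G ((q.1.1 : ℝ) / n) - G ((q.1.2 : ℝ) / n)) * p (q.1.1 - q.1.2) * η q.1.2)
      + (n : ℝ) *
        (∑' q : F, (G ((q.1.1 : ℝ) / n) - G ((q.1.2 : ℝ) / n)) * p (q.1.1 - q.1.2) * η q.1.2) := by
  subst hF
  have hn0 : n ≠ 0 := by omega
  have hnR : (n : ℝ) ≠ 0 := Nat.cast_ne_zero.mpr hn0
  have hg : Summable fun x : ℤ => G ((x : ℝ) / n) :=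
    summable_of_hasFiniteSupport (finite_support_lattice hGc hn0)
  obtain ⟨a, ha_apply⟩ : ∃ a : ℤ × ℤ → ℝ, ∀ q : ℤ × ℤ,
      (G ((q.1 : ℝ) / n) - G ((q.2 : ℝ) / n)) * p (q.1 - q.2) = a q := ⟨_, fun _ => rfl⟩
  have ha : Summable a := (summable_increment_kernel hg hpsum hpsymm).congr ha_apply
  have hp_swap : ∀ x z : ℤ, p (z - x) = p (x - z) := fun x z => by rw [← hpsymm, neg_sub]
  have ha_swap : ∀ q, a q.swap = -a q := fun q => by
    simp only [← ha_apply, Prod.fst_swap, Prod.snd_swap, hp_swap q.1 q.2]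
    ring
  have hη1 : ∀ x, |η x| ≤ 1 := fun x => by rcases hη x with h | h <;> simp [h]
  have hfst : Summable fun q : ℤ × ℤ => a q * η q.1 :=
    summable_mul_of_abs_le_one ha fun q => hη1 q.1
  have hsnd : Summable fun q : ℤ × ℤ => a q * η q.2 :=
    summable_mul_of_abs_le_one ha fun q => hη1 q.2
  have hae : ∀ z y : ℤ,
      a (z + y, z) = (G (((z : ℝ) + y) / n) - G ((z : ℝ) / n)) * p y := fun z y => by
    simp [← ha_apply]
  have hinner : ∀ z : ℤ,
      Summable fun y : ℤ => (G (((z : ℝ) + y) / n) - G ((z : ℝ) / n)) * p y := fun z =>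
    ((summable_shear ha).prod_factor z).congr (hae z)
  have hiter : ∀ z : ℤ, ∑' y : ℤ, a (z + y, z) * η z =
      (∑' y : ℤ, (G (((z : ℝ) + y) / n) - G ((z : ℝ) / n)) * p y) * η z := fun z => by
    rw [tsum_mul_right, tsum_congr (hae z)]
  have houter : Summable fun z : ℤ =>
      (∑' y : ℤ, (G (((z : ℝ) + y) / n) - G ((z : ℝ) / n)) * p y) * η z :=
    (summable_shear hsnd).prod.congr hiter
  have hgen : ∑' z : ℤ, (∑' y : ℤ, (G (((z : ℝ) + y) / n) - G ((z : ℝ) / n)) * p y) * η z =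
      ∑' q : ℤ × ℤ, a q * η q.2 :=
    (tsum_congr hiter).symm.trans (tsum_tsum_shear hsnd)
  have hsplit := tsum_eq_add_tsum_off_diagonal (S := S) hsnd fun x => by simp [← ha_apply]
  have hanti := tsum_antisymm_swap hSswap ha_swap η
  have hfstS : Summable fun q : S => a q * η q.1.1 := hfst.subtype S
  have hsndS : Summable fun q : S => a q * η q.1.2 := hsnd.subtype S
  have hsndF : Summable fun q : {q : ℤ × ℤ | q.1 ≠ q.2 ∧ q ∉ S} => a q * η q.1.2 :=
    hsnd.subtype _
  have hexchS : Summable fun q : S => a q * η q.1.1 - a q * η q.1.2 := hfstS.sub hsndS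
  have hexch : ∀ q : S, (G ((q.1.1 : ℝ) / n) - G ((q.1.2 : ℝ) / n)) * p (q.1.2 - q.1.1)
      * (η q.1.1 - η q.1.2) = a q * η q.1.1 - a q * η q.1.2 := fun q => by
    rw [hp_swap q.1.1 q.1.2, ha_apply, mul_sub]
  simp only [ha_apply]
  refine ⟨hinner, ?_, hexchS.congr fun q => (hexch q).symm, hsndS, hsndF, ?_⟩
  · exact (houter.mul_left ((n : ℝ) ^ 2)).congr fun z => by ring
  · have hpow : (n : ℝ) ^ ((1 : ℝ) - β) = n * (n : ℝ) ^ (-β) := by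
      rw [sub_eq_add_neg, Real.rpow_add (by positivity), Real.rpow_one]
    simp_rw [mul_assoc ((n : ℝ) ^ 2)]
    rw [tsum_mul_left, hgen, tsum_congr hexch, hfstS.tsum_sub hsndS, hanti, hsplit, hpow]
    generalize (n : ℝ) ^ (-β) = c
    field_simp
    ring
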